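/- Let σ₀ > 1 and n ∈ ℕ. Then there exists a relatively dense set T ⊆ ℝ (i.e., there is L > 0 such that every interval of length L in ℝ contains a point of T) with the following property: for every t ∈ T there exist a continuous function φ : (1, σ₀) → ℝ with S_a(σ + it) = |S_a(σ + it)|·e^{iφ(σ)} for all σ ∈ (1, σ₀), and points σ₁, σ₂ ∈ (1, σ₀) with φ(σ₁) - φ(σ₂) ≥ 2πn; that is, the parametrized curve σ ↦ S_a(σ + it), σ ∈ (1, σ₀), makes at least n turns around the origin. -/

import Mathlib

open Real

open MeasureTheory AddCircle UnitAddTorus in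
theorem UnitAddTorus.integral_mFourier_eq_zero {ι : Type*} [Fintype ι] {k : ι → ℤ} (hk : k ≠ 0) :
    ∫ y, mFourier k y ∂(Measure.pi fun _ : ι => (haarAddCircle : Measure UnitAddCircle)) = 0 := by
  obtain ⟨i, hi⟩ := Function.ne_iff.mp hk
  simp only [mFourier, ContinuousMap.coe_mk]
  rw [integral_fintype_prod_eq_prod (fun i (y : UnitAddCircle) => (fourier (k i) y : ℂ))]
  exact Finset.prod_eq_zero (Finset.mem_univ i) <|
    integral_eq_zero_of_add_right_eq_neg (μ := haarAddCircle)
      (fourier_add_half_inv_index hi one_pos)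

/-- The linear flow on the torus with frequency vector `ω`. -/
noncomputable def UnitAddTorus.linearFlow {ι : Type*} (ω : ι → ℝ) (t : ℝ) : UnitAddTorus ι :=
  fun i => ((t * ω i : ℝ) : UnitAddCircle)

theorem UnitAddTorus.continuous_linearFlow {ι : Type*} (ω : ι → ℝ) :
    Continuous (linearFlow ω) :=
  continuous_pi fun i => (AddCircle.continuous_mk' 1).comp (by fun_prop)

theorem UnitAddTorus.mFourier_linearFlow {ι : Type*} [Fintype ι] (ω : ι → ℝ) (k : ι → ℤ) (t : ℝ) :
    mFourier k (linearFlow ω t) =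
      Complex.exp ((2 * π * (∑ i, k i * ω i : ℝ) : ℝ) * Complex.I * t) := by
  simp only [mFourier, linearFlow, ContinuousMap.coe_mk, fourier_coe_apply, ← Complex.exp_sum]
  congr 1
  push_cast
  simp only [Finset.mul_sum, Finset.sum_mul]
  refine Finset.sum_congr rfl fun i _ => ?_
  ring

open MeasureTheory AddCircle UnitAddTorus in
/-- Weyl equidistribution for rationally independent linear flows on the torus, uniformly in the
starting point of the averaging window. -/
theorem UnitAddTorus.norm_integral_linearFlow_sub_le {ι : Type*} [Fintype ι] {ω : ι → ℝ}
    (hω : ∀ k : ι → ℤ, ∑ i, k i * ω i = 0 → k = 0) (g : C(UnitAddTorus ι, ℂ))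
    {ε : ℝ} (hε : 0 < ε) :
    ∃ L₀ > 0, ∀ L ≥ L₀, ∀ x : ℝ,
      ‖(∫ t in x..(x + L), g (linearFlow ω t)) -
        L * ∫ y, g y ∂(Measure.pi fun _ : ι => (haarAddCircle : Measure UnitAddCircle))‖
        ≤ ε * L := by
  set μ := Measure.pi fun _ : ι => (haarAddCircle : Measure UnitAddCircle) with hμ
  have hint (g : C(UnitAddTorus ι, ℂ)) : Integrable g μ :=
    g.continuous.integrable_of_hasCompactSupport (.of_compactSpace _)
  have hint' (g : C(UnitAddTorus ι, ℂ)) (a b : ℝ) :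
      IntervalIntegrable (fun t => g (linearFlow ω t)) volume a b :=
    (g.continuous.comp (continuous_linearFlow ω)).intervalIntegrable a b
  have hspan : ∀ h ∈ Submodule.span ℂ (Set.range (mFourier (d := ι))), ∃ C : ℝ, ∀ L : ℝ, ∀ x : ℝ,
      ‖(∫ t in x..(x + L), h (linearFlow ω t)) - L * ∫ y, h y ∂μ‖ ≤ C := by
    intro h hh
    induction hh using Submodule.span_induction with
    | mem h hh =>
      obtain ⟨k, rfl⟩ := hh
      by_cases hk : k = 0
      · subst hk
        refine ⟨0, fun L x => ?_⟩
        simp [mFourier_zero]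
      · set c : ℂ := (2 * π * (∑ i, k i * ω i : ℝ) : ℝ) * Complex.I with hc
        have hc0 : c ≠ 0 := by
          have : ∑ i, k i * ω i ≠ 0 := fun h => hk (hω k h)
          simp only [hc, ne_eq, mul_eq_zero, Complex.I_ne_zero, or_false, Complex.ofReal_eq_zero]
          simp [pi_ne_zero, this]
        refine ⟨2 / ‖c‖, fun L x => ?_⟩
        have hexp (s : ℝ) : ‖Complex.exp (c * s)‖ = 1 := by
          rw [show c * s = ((2 * π * (∑ i, k i * ω i : ℝ) * s : ℝ)) * Complex.I by
            rw [hc]; push_cast; ring]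
          exact Complex.norm_exp_ofReal_mul_I _
        simp only [mFourier_linearFlow, ← hc, integral_exp_mul_complex hc0, hμ,
          integral_mFourier_eq_zero hk, mul_zero, sub_zero, norm_div]
        gcongr
        exact (norm_sub_le _ _).trans (by rw [hexp, hexp]; norm_num)
    | zero => exact ⟨0, fun L x => by simp⟩
    | add f h _ _ hf hh =>
      obtain ⟨C, hC⟩ := hf
      obtain ⟨D, hD⟩ := hh
      refine ⟨C + D, fun L x => ?_⟩
      simp only [ContinuousMap.add_apply]
      rw [intervalIntegral.integral_add (hint' f _ _) (hint' h _ _),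
        integral_add (hint f) (hint h), mul_add, add_sub_add_comm]
      exact (norm_add_le _ _).trans (add_le_add (hC L x) (hD L x))
    | smul a h _ hh =>
      obtain ⟨C, hC⟩ := hh
      refine ⟨‖a‖ * C, fun L x => ?_⟩
      simp only [ContinuousMap.smul_apply, smul_eq_mul]
      rw [intervalIntegral.integral_const_mul, integral_const_mul, mul_left_comm, ← mul_sub,
        norm_mul]
      exact mul_le_mul_of_nonneg_left (hC L x) (norm_nonneg a)
  have hg : g ∈ (Submodule.span ℂ (Set.range (mFourier (d := ι)))).topologicalClosure := by
    rw [span_mFourier_closure_eq_top]; trivial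
  obtain ⟨h, hh, hgh⟩ := Metric.mem_closure_iff.mp hg (ε / 3) (by positivity)
  obtain ⟨C, hC⟩ := hspan h hh
  have hC0 : 0 ≤ C := (norm_nonneg _).trans (hC 0 0)
  have hpt (y) : ‖g y - h y‖ ≤ ε / 3 := by
    rw [← dist_eq_norm]
    exact (ContinuousMap.dist_apply_le_dist y).trans hgh.le
  refine ⟨3 * (C + 1) / ε, by positivity, fun L hL x => ?_⟩
  have hL0 : 0 < L := lt_of_lt_of_le (by positivity) hL
  have hCL : C ≤ ε / 3 * L := by
    rw [ge_iff_le, div_le_iff₀ hε] at hL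
    linarith
  have hflow : ‖(∫ t in x..(x + L), g (linearFlow ω t)) -
      ∫ t in x..(x + L), h (linearFlow ω t)‖ ≤ ε / 3 * L := by
    rw [← intervalIntegral.integral_sub (hint' g _ _) (hint' h _ _)]
    have := intervalIntegral.norm_integral_le_of_norm_le_const (a := x) (b := x + L)
      (f := fun t => g (linearFlow ω t) - h (linearFlow ω t)) (C := ε / 3) fun t _ => hpt _
    simpa [abs_of_pos hL0] using this
  have hmean : ‖(L : ℂ) * (∫ y, h y ∂μ) - L * ∫ y, g y ∂μ‖ ≤ ε / 3 * L := by
    rw [← mul_sub, ← integral_sub (hint h) (hint g), norm_mul, Complex.norm_real,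
      Real.norm_of_nonneg hL0.le, mul_comm]
    refine mul_le_mul_of_nonneg_right ?_ hL0.le
    have := norm_integral_le_of_norm_le_const (μ := μ) (f := fun y => h y - g y) (C := ε / 3)
      (.of_forall fun y => by rw [norm_sub_rev]; exact hpt y)
    simpa using this
  have := hC L x
  calc _ = ‖((∫ t in x..(x + L), g (linearFlow ω t)) - ∫ t in x..(x + L), h (linearFlow ω t)) +
        ((∫ t in x..(x + L), h (linearFlow ω t)) - L * ∫ y, h y ∂μ) +
        ((L : ℂ) * (∫ y, h y ∂μ) - L * ∫ y, g y ∂μ)‖ := by congr 1; ring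
    _ ≤ ε / 3 * L + C + ε / 3 * L := norm_add₃_le.trans (by gcongr)
    _ ≤ ε * L := by linarith

open MeasureTheory AddCircle UnitAddTorus in
/-- Kronecker's theorem: a rationally independent linear flow on the torus visits every nonempty
open set along a relatively dense set of times. -/
theorem UnitAddTorus.exists_linearFlow_mem {ι : Type*} [Fintype ι] {ω : ι → ℝ}
    (hω : ∀ k : ι → ℤ, ∑ i, k i * ω i = 0 → k = 0) {U : Set (UnitAddTorus ι)} (hU : IsOpen U)
    (hne : U.Nonempty) :
    ∃ L > 0, ∀ x : ℝ, ∃ t ∈ Set.Icc x (x + L), linearFlow ω t ∈ U := by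
  obtain ⟨u, hu⟩ := hne
  obtain ⟨r, hr, hball⟩ := Metric.isOpen_iff.mp hU u hu
  set μ := Measure.pi fun _ : ι => (haarAddCircle : Measure UnitAddCircle) with hμ
  let b : UnitAddTorus ι → ℝ := fun y => max 0 (r - dist y u)
  have hb : Continuous b := by fun_prop
  have hpos : 0 < ∫ y, b y ∂μ :=
    hb.integral_pos_of_hasCompactSupport_nonneg_nonzero (x := u) (.of_compactSpace _)
      (fun y => le_max_left _ _) (by simp [b, hr.ne', hr.le])
  obtain ⟨L, hL, hLx⟩ := norm_integral_linearFlow_sub_le hω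
    ⟨fun y => (b y : ℂ), by fun_prop⟩ (half_pos hpos)
  refine ⟨L, hL, fun x => ?_⟩
  by_contra! hx
  have hzero : ∫ t in x..(x + L), (b (linearFlow ω t) : ℂ) = 0 := by
    refine (intervalIntegral.integral_congr (g := fun _ => 0) fun t ht => ?_).trans (by simp)
    rw [Set.uIcc_of_le (by linarith)] at ht
    have : r ≤ dist (linearFlow ω t) u := by
      by_contra! h
      exact hx t ht (hball h)
    simp [b, this]
  have h := hLx L le_rfl x
  simp only [ContinuousMap.coe_mk, hzero, zero_sub, norm_neg, ← hμ, integral_complex_ofReal] at h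
  rw [norm_mul, Complex.norm_real, Complex.norm_real, norm_of_nonneg hL.le,
    norm_of_nonneg hpos.le] at h
  nlinarith

theorem Nat.Primes.sum_intCast_mul_log_eq_zero {P : Finset Nat.Primes} {k : P → ℤ}
    (h : ∑ p : P, k p * Real.log (p : ℕ) = 0) : k = 0 := by
  have hlog (e : P → ℕ) :
      Real.log ((∏ p : P, ((p : ℕ) ^ e p) : ℕ) : ℝ) = ∑ p : P, e p * Real.log (p : ℕ) := by
    push_cast
    rw [Real.log_prod fun p _ => pow_ne_zero _ (Nat.cast_ne_zero.mpr p.1.2.ne_zero)]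
    simp
  have hne (e : P → ℕ) : (∏ p : P, ((p : ℕ) ^ e p)) ≠ 0 :=
    Finset.prod_ne_zero_iff.mpr fun p _ => pow_ne_zero _ p.1.2.ne_zero
  have hfac (e : P → ℕ) (q : P) : (∏ p : P, ((p : ℕ) ^ e p)).factorization q = e q := by
    rw [Nat.factorization_prod fun p _ => pow_ne_zero _ p.1.2.ne_zero, Finset.sum_apply']
    rw [Finset.sum_eq_single q]
    · rw [Nat.Prime.factorization_pow q.1.2, Finsupp.single_eq_same]
    · intro p _ hp
      rw [Nat.Prime.factorization_pow p.1.2]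
      exact Finsupp.single_eq_of_ne' fun h => hp (Subtype.ext (Nat.Primes.coe_nat_injective h))
    · simp
  have heq : (∏ p : P, ((p : ℕ) ^ (k p).toNat)) = ∏ p : P, ((p : ℕ) ^ (-k p).toNat) := by
    refine Nat.cast_injective (R := ℝ) <| Real.log_injOn_pos ?_ ?_ ?_
    · exact Set.mem_Ioi.mpr (Nat.cast_pos.mpr (Nat.pos_of_ne_zero (hne _)))
    · exact Set.mem_Ioi.mpr (Nat.cast_pos.mpr (Nat.pos_of_ne_zero (hne _)))
    · rw [hlog, hlog, ← sub_eq_zero, ← Finset.sum_sub_distrib, ← h]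
      refine Finset.sum_congr rfl fun p _ => ?_
      rw [← sub_mul]
      congr 1
      exact_mod_cast Int.toNat_sub_toNat_neg (k p)
  funext q
  have := congr_arg (fun m => m.factorization q) heq
  simp only [hfac] at this
  simp only [Pi.zero_apply]
  omega

/-- Kronecker's theorem for the logarithms of the primes. -/
theorem Nat.Primes.exists_norm_cpow_sub_lt (P : Finset Nat.Primes) {u : Nat.Primes → ℂ}
    (hu : ∀ p, ‖u p‖ = 1) {ε : ℝ} (hε : 0 < ε) :
    ∃ L > 0, ∀ x : ℝ, ∃ t ∈ Set.Icc x (x + L),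
      ∀ p ∈ P, ‖(p : ℂ) ^ (-(t * Complex.I)) - u p‖ < ε := by
  have hω (k : P → ℤ) (hk : ∑ p, k p * (-(Real.log (p : ℕ) / (2 * π))) = 0) : k = 0 := by
    refine Nat.Primes.sum_intCast_mul_log_eq_zero ?_
    have : ∑ p : P, k p * Real.log (p : ℕ) =
        -(2 * π) * ∑ p, k p * (-(Real.log (p : ℕ) / (2 * π))) := by
      rw [Finset.mul_sum]
      refine Finset.sum_congr rfl fun p _ => ?_
      field_simp
    rw [this, hk, mul_zero]
  obtain ⟨L, hL, h⟩ := UnitAddTorus.exists_linearFlow_mem hω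
    (U := {y | ∀ p : P, ‖(AddCircle.toCircle (y p) : ℂ) - u p‖ < ε})
    (by
      simp only [Set.ofPred_forall]
      refine isOpen_iInter_of_finite fun p => isOpen_lt ?_ continuous_const
      have := (AddCircle.continuous_toCircle (T := 1)).comp
        (continuous_apply (A := fun _ : P => UnitAddCircle) p)
      exact ((continuous_induced_dom.comp this).sub continuous_const).norm)
    (by
      refine ⟨fun p => ((Complex.arg (u p) / (2 * π) : ℝ) : UnitAddCircle), fun p => ?_⟩
      rw [AddCircle.toCircle_apply_mk, Circle.coe_exp]
      have : 2 * π / 1 * (Complex.arg (u p) / (2 * π)) = Complex.arg (u p) := by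
        field_simp
      have h2 := Complex.norm_mul_exp_arg_mul_I (u p)
      rw [hu, Complex.ofReal_one, one_mul] at h2
      rw [this, h2]
      simpa using hε)
  refine ⟨L, hL, fun x => ?_⟩
  obtain ⟨t, ht, htU⟩ := h x
  refine ⟨t, ht, fun p hp => ?_⟩
  have := htU ⟨p, hp⟩
  rw [UnitAddTorus.linearFlow, AddCircle.toCircle_apply_mk, Circle.coe_exp] at this
  convert this using 3
  rw [Complex.cpow_def_of_ne_zero (Nat.cast_ne_zero.mpr p.2.ne_zero), ← Complex.ofReal_natCast,
    ← Complex.ofReal_log (Nat.cast_nonneg _)]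
  congr 1
  push_cast
  field_simp

theorem Complex.norm_neg_log_one_sub_le {z : ℂ} (hz : ‖z‖ ≤ 1 / 2) :
    ‖-log (1 - z)‖ ≤ 3 / 2 * ‖z‖ := by
  simpa [sub_eq_add_neg] using norm_log_one_add_half_le_self (z := -z) (by simpa using hz)

theorem Complex.norm_neg_log_one_sub_sub_self_le {z : ℂ} (hz : ‖z‖ ≤ 1 / 2) :
    ‖-log (1 - z) - z‖ ≤ ‖z‖ ^ 2 := by
  have h := norm_log_one_add_sub_self_le (z := -z) (by rw [norm_neg]; linarith)
  rw [norm_neg, ← sub_eq_add_neg, ← norm_neg] at h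
  rw [show -log (1 - z) - z = -(log (1 - z) - -z) by ring]
  refine h.trans ?_
  have : (1 - ‖z‖)⁻¹ ≤ 2 := by
    rw [inv_le_comm₀ (by linarith) two_pos]
    linarith
  nlinarith [sq_nonneg ‖z‖]

theorem Nat.Primes.rpow_neg_le_half (p : Nat.Primes) {σ : ℝ} (hσ : 1 ≤ σ) :
    (p : ℝ) ^ (-σ) ≤ 1 / 2 := by
  have h2 : (2 : ℝ) ≤ p := by exact_mod_cast p.2.two_le
  calc (p : ℝ) ^ (-σ) ≤ (p : ℝ) ^ (-1 : ℝ) :=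
        Real.rpow_le_rpow_of_exponent_le (by linarith) (by linarith)
    _ = (p : ℝ)⁻¹ := Real.rpow_neg_one _
    _ ≤ 1 / 2 := by rw [one_div]; gcongr

theorem Nat.Primes.exists_le_tsum_rpow_neg (M : ℝ) {σ₀ : ℝ} (hσ₀ : 1 < σ₀) :
    ∃ σ ∈ Set.Ioo 1 σ₀, M ≤ ∑' p : Nat.Primes, (p : ℝ) ^ (-σ) := by
  obtain ⟨Q, hQ⟩ : ∃ Q : Finset Nat.Primes, M < ∑ p ∈ Q, (p : ℝ) ^ (-1 : ℝ) := by
    by_contra! h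
    have := summable_of_sum_le (fun p : Nat.Primes => Real.rpow_nonneg p.1.cast_nonneg (-1)) h
    exact lt_irrefl _ (Nat.Primes.summable_rpow.mp this)
  have hcont : Continuous fun σ : ℝ => ∑ p ∈ Q, (p : ℝ) ^ (-σ) :=
    continuous_finsetSum _ fun p _ =>
      Real.continuous_const_rpow (Nat.cast_ne_zero.mpr p.2.ne_zero) |>.comp continuous_neg
  have hev := (hcont.continuousWithinAt (s := Set.Ioi 1) (x := 1)).eventually_const_lt hQ
  obtain ⟨σ, hσM, hσ⟩ := (hev.and (Ioo_mem_nhdsGT hσ₀)).exists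
  refine ⟨σ, hσ, hσM.le.trans ?_⟩
  exact (Nat.Primes.summable_rpow.mpr (by linarith [hσ.1])).sum_le_tsum Q
    fun p _ => Real.rpow_nonneg p.1.cast_nonneg _

section CompletelyMultiplicative

variable {a : ℕ → ℂ}

theorem norm_eq_one_of_norm_prime_eq_one (ha1 : a 1 = 1)
    (hmul : ∀ m n : ℕ, m ≠ 0 → n ≠ 0 → a (m * n) = a m * a n)
    (haprime : ∀ p : ℕ, p.Prime → ‖a p‖ = 1) {n : ℕ} (hn : n ≠ 0) : ‖a n‖ = 1 := by
  induction n using Nat.recOnMul with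
  | zero => exact absurd rfl hn
  | one => rw [ha1, norm_one]
  | prime p hp => exact haprime p hp
  | mul m n hm hn' =>
    obtain ⟨hm0, hn0⟩ := mul_ne_zero_iff.mp hn
    rw [hmul m n hm0 hn0, norm_mul, hm hm0, hn' hn0, one_mul]

/-- The Euler product of a completely multiplicative unimodular function, in exponential form. -/
theorem LSeries_eq_exp_tsum_primes (ha1 : a 1 = 1)
    (hmul : ∀ m n : ℕ, m ≠ 0 → n ≠ 0 → a (m * n) = a m * a n)
    (haprime : ∀ p : ℕ, p.Prime → ‖a p‖ = 1) {s : ℂ} (hs : 1 < s.re) :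
    LSeries a s =
      Complex.exp (∑' p : Nat.Primes, -Complex.log (1 - a p * (p : ℂ) ^ (-s))) := by
  let f : ℕ →*₀ ℂ :=
    { toFun := LSeries.term a s
      map_zero' := LSeries.term_zero a s
      map_one' := by simp [ha1]
      map_mul' := fun m n => by
        rcases eq_or_ne m 0 with rfl | hm
        · simp
        rcases eq_or_ne n 0 with rfl | hn
        · simp
        rw [LSeries.term_of_ne_zero (mul_ne_zero hm hn), LSeries.term_of_ne_zero hm,
          LSeries.term_of_ne_zero hn, hmul m n hm hn, Nat.cast_mul,
          Complex.natCast_mul_natCast_cpow, mul_div_mul_comm] }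
  have hsum : Summable (‖f ·‖) :=
    (LSeriesSummable_of_bounded_of_one_lt_re (m := 1)
      (fun n hn => (norm_eq_one_of_norm_prime_eq_one ha1 hmul haprime hn).le) hs).norm
  refine (EulerProduct.exp_tsum_primes_log_eq_tsum hsum).symm.trans ?_
  congr 1
  refine tsum_congr fun p => ?_
  change -Complex.log (1 - LSeries.term a s p) = _
  rw [LSeries.term_of_ne_zero p.2.ne_zero, Complex.cpow_neg, div_eq_mul_inv]

theorem norm_mul_prime_cpow_neg (haprime : ∀ p : ℕ, p.Prime → ‖a p‖ = 1)
    (p : Nat.Primes) (σ t : ℝ) :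
    ‖a p * (p : ℂ) ^ (-(σ + t * Complex.I))‖ = (p : ℝ) ^ (-σ) := by
  rw [norm_mul, haprime p p.2, one_mul, Complex.norm_natCast_cpow_of_pos p.2.pos]
  simp

/-- The logarithm of `LSeries a` at `σ + it` given by its Euler product. -/
noncomputable def eulerLog (a : ℕ → ℂ) (σ t : ℝ) : ℂ :=
  ∑' p : Nat.Primes, -Complex.log (1 - a p * (p : ℂ) ^ (-(σ + t * Complex.I)))

theorem norm_eulerLog_term_le (haprime : ∀ p : ℕ, p.Prime → ‖a p‖ = 1) (p : Nat.Primes)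
    {σ : ℝ} (hσ : 1 ≤ σ) (t : ℝ) :
    ‖-Complex.log (1 - a p * (p : ℂ) ^ (-(σ + t * Complex.I)))‖ ≤ 3 / 2 * (p : ℝ) ^ (-σ) := by
  rw [← norm_mul_prime_cpow_neg haprime p σ t]
  refine Complex.norm_neg_log_one_sub_le ?_
  rw [norm_mul_prime_cpow_neg haprime]
  exact p.rpow_neg_le_half hσ

theorem summable_rpow_neg_mul {σ : ℝ} (hσ : 1 < σ) (c : ℝ) :
    Summable fun p : Nat.Primes => c * (p : ℝ) ^ (-σ) :=
  (Nat.Primes.summable_rpow.mpr (by linarith)).mul_left c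

theorem summable_eulerLog (haprime : ∀ p : ℕ, p.Prime → ‖a p‖ = 1) {σ : ℝ} (hσ : 1 < σ) (t : ℝ) :
    Summable fun p : Nat.Primes =>
      -Complex.log (1 - a p * (p : ℂ) ^ (-(σ + t * Complex.I))) :=
  .of_norm_bounded (summable_rpow_neg_mul hσ _) fun p => norm_eulerLog_term_le haprime p hσ.le t

theorem norm_eulerLog_le (haprime : ∀ p : ℕ, p.Prime → ‖a p‖ = 1) {σ : ℝ} (hσ : 1 < σ) (t : ℝ) :
    ‖eulerLog a σ t‖ ≤ ∑' p : Nat.Primes, 3 / 2 * (p : ℝ) ^ (-σ) :=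
  tsum_of_norm_bounded (summable_rpow_neg_mul hσ _).hasSum
    fun p => norm_eulerLog_term_le haprime p hσ.le t

theorem continuousOn_eulerLog (haprime : ∀ p : ℕ, p.Prime → ‖a p‖ = 1) (t : ℝ) :
    ContinuousOn (fun σ => eulerLog a σ t) (Set.Ioi 1) := by
  intro σ hσ
  obtain ⟨r, hr1, hrσ⟩ := exists_between (Set.mem_Ioi.mp hσ)
  refine (ContinuousOn.continuousAt ?_ (Ioi_mem_nhds hrσ)).continuousWithinAt
  refine continuousOn_tsum (fun p => ?_) (summable_rpow_neg_mul hr1 (3 / 2)) fun p x hx => ?_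
  · have hp : (p : ℂ) ≠ 0 := Nat.cast_ne_zero.mpr p.2.ne_zero
    refine (ContinuousOn.clog ?_ fun x hx => ?_).neg
    · refine continuousOn_const.sub (continuousOn_const.mul (Continuous.continuousOn ?_))
      exact Continuous.const_cpow (by fun_prop) (.inl hp)
    · rw [sub_eq_add_neg]
      refine Complex.mem_slitPlane_of_norm_lt_one ?_
      rw [norm_neg, norm_mul_prime_cpow_neg haprime]
      exact (p.rpow_neg_le_half (hr1.trans hx).le).trans_lt (by norm_num)
  · refine (norm_eulerLog_term_le haprime p (hr1.trans hx).le t).trans ?_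
    have : (1 : ℝ) ≤ p := by exact_mod_cast p.2.one_le
    have hx' : r < x := hx
    gcongr

/-- If the twisted coefficients `a p * p ^ (-it)` are close to `i` for the primes in `P`, then the
argument of the Euler product at `σ + it` is large. -/
theorem le_im_eulerLog (haprime : ∀ p : ℕ, p.Prime → ‖a p‖ = 1) {σ t : ℝ} (hσ : 1 < σ)
    {P : Finset Nat.Primes}
    (hP : ∀ p ∈ P, 1 / 2 ≤ (a p * (p : ℂ) ^ (-(t * Complex.I))).im) :
    3 / 2 * ∑ p ∈ P, (p : ℝ) ^ (-σ) - ∑' p : Nat.Primes, (p : ℝ) ^ (-σ)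
      - ∑' p : Nat.Primes, (p : ℝ) ^ (-2 : ℝ) ≤ (eulerLog a σ t).im := by
  classical
  have hσs : Summable fun p : Nat.Primes => (p : ℝ) ^ (-σ) :=
    Nat.Primes.summable_rpow.mpr (by linarith)
  have h2s : Summable fun p : Nat.Primes => (p : ℝ) ^ (-2 : ℝ) :=
    Nat.Primes.summable_rpow.mpr (by norm_num)
  have hPs : HasSum (fun p : Nat.Primes => if p ∈ P then 3 / 2 * (p : ℝ) ^ (-σ) else 0)
      (3 / 2 * ∑ p ∈ P, (p : ℝ) ^ (-σ)) := by
    rw [Finset.mul_sum, ← Finset.sum_congr rfl fun p hp => if_pos hp]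
    exact hasSum_sum_of_ne_finset_zero fun p hp => if_neg hp
  refine hasSum_le (fun p => ?_) ((hPs.sub hσs.hasSum).sub h2s.hasSum)
    (Complex.hasSum_im (summable_eulerLog haprime hσ t).hasSum)
  set z := a p * (p : ℂ) ^ (-(σ + t * Complex.I)) with hz
  have hnorm : ‖z‖ = (p : ℝ) ^ (-σ) := norm_mul_prime_cpow_neg haprime p σ t
  have hp1 : (1 : ℝ) ≤ p := by exact_mod_cast p.2.one_le
  have hsq : ‖z‖ ^ 2 ≤ (p : ℝ) ^ (-2 : ℝ) := by
    rw [hnorm, ← Real.rpow_mul_natCast (by linarith)]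
    exact Real.rpow_le_rpow_of_exponent_le hp1 (by push_cast; linarith)
  have herr := Complex.norm_neg_log_one_sub_sub_self_le
    (z := z) (hnorm.trans_le (p.rpow_neg_le_half hσ.le))
  have him := (abs_le.mp ((Complex.abs_im_le_norm _).trans (herr.trans hsq))).1
  rw [Complex.sub_im] at him
  have hzim : (if p ∈ P then 3 / 2 * (p : ℝ) ^ (-σ) else 0) - (p : ℝ) ^ (-σ) ≤ z.im := by
    split_ifs with hp
    · have hfac : z = ((p : ℝ) ^ (-σ) : ℝ) * (a p * (p : ℂ) ^ (-(t * Complex.I))) := by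
        rw [hz, neg_add, Complex.cpow_add _ _ (Nat.cast_ne_zero.mpr p.2.ne_zero),
          Complex.ofReal_cpow (by linarith)]
        push_cast
        ring
      rw [hfac, Complex.im_ofReal_mul]
      nlinarith [hP p hp, Real.rpow_nonneg (zero_le_one.trans hp1) (-σ)]
    · rw [zero_sub, ← hnorm]
      exact (abs_le.mp (Complex.abs_im_le_norm z)).1
  linarith

end CompletelyMultiplicative

/-- Let `σ₀ > 1` and `n ∈ ℕ`. There is a relatively dense set `T ⊆ ℝ` such that
for every `t ∈ T` the parametrized curve `σ ↦ S_a(σ + it)`, `σ ∈ (1, σ₀)`, makes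
at least `n` turns around the origin: there is a continuous argument function
`φ` on `(1, σ₀)` whose total variation exceeds `2πn`. -/
theorem vortex_behavior_LSeries
    (a : ℕ → ℂ) (ha1 : a 1 = 1)
    (hmul : ∀ m n : ℕ, m ≠ 0 → n ≠ 0 → a (m * n) = a m * a n)
    (haprime : ∀ p : ℕ, p.Prime → ‖a p‖ = 1)
    (σ₀ : ℝ) (hσ₀ : 1 < σ₀) (n : ℕ) :
    ∃ T : Set ℝ,
      (∃ L : ℝ, 0 < L ∧ ∀ x : ℝ, ∃ t ∈ T, t ∈ Set.Icc x (x + L)) ∧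
      ∀ t ∈ T, ∃ φ : ℝ → ℝ,
        ContinuousOn φ (Set.Ioo 1 σ₀) ∧
        (∀ σ ∈ Set.Ioo 1 σ₀,
          LSeries a (σ + t * Complex.I) =
            (‖LSeries a (σ + t * Complex.I)‖ : ℂ) *
              Complex.exp ((φ σ : ℂ) * Complex.I)) ∧
        ∃ σ₁ ∈ Set.Ioo 1 σ₀, ∃ σ₂ ∈ Set.Ioo 1 σ₀,
          φ σ₁ - φ σ₂ ≥ 2 * π * n := by
  set C₁ := ∑' p : Nat.Primes, 3 / 2 * (p : ℝ) ^ (-((1 + σ₀) / 2))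
  set C₂ := ∑' p : Nat.Primes, (p : ℝ) ^ (-2 : ℝ)
  obtain ⟨σ₁, hσ₁, hM⟩ :=
    Nat.Primes.exists_le_tsum_rpow_neg (2 * (2 * π * n + 3 / 2 + C₁ + C₂)) hσ₀
  have hσ₂ : (1 + σ₀) / 2 ∈ Set.Ioo 1 σ₀ := ⟨by linarith, by linarith⟩
  have hsum : Summable fun p : Nat.Primes => (p : ℝ) ^ (-σ₁) :=
    Nat.Primes.summable_rpow.mpr (by linarith [hσ₁.1])
  obtain ⟨P, hP⟩ :=
    (hsum.hasSum.eventually_const_lt (sub_one_lt (∑' p : Nat.Primes, (p : ℝ) ^ (-σ₁)))).exists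
  obtain ⟨L, hL, hT⟩ := Nat.Primes.exists_norm_cpow_sub_lt P
    (u := fun p => Complex.I / a p) (fun p => by simp [haprime p p.2]) one_half_pos
  refine ⟨{t | ∀ p ∈ P, ‖(p : ℂ) ^ (-(t * Complex.I)) - Complex.I / a p‖ < 1 / 2}, ⟨L, hL,
    fun x => (hT x).imp fun t ht => ht.symm⟩, fun t ht => ⟨fun σ => (eulerLog a σ t).im,
    ?_, fun σ hσ => ?_, σ₁, hσ₁, (1 + σ₀) / 2, hσ₂, ?_⟩⟩
  · exact Complex.continuous_im.comp_continuousOn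
      ((continuousOn_eulerLog haprime t).mono Set.Ioo_subset_Ioi_self)
  · rw [LSeries_eq_exp_tsum_primes ha1 hmul haprime (by simpa using hσ.1), ← eulerLog,
      Complex.norm_exp, Complex.ofReal_exp, ← Complex.exp_add, Complex.re_add_im]
  · have hlow := le_im_eulerLog haprime hσ₁.1 (t := t) (P := P) fun p hp => by
      have hap : a p ≠ 0 := norm_ne_zero_iff.mp (by simp [haprime p p.2])
      have hclose : ‖a p * (p : ℂ) ^ (-(t * Complex.I)) - Complex.I‖ < 1 / 2 := by
        rw [show a p * (p : ℂ) ^ (-(t * Complex.I)) - Complex.I =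
          a p * ((p : ℂ) ^ (-(t * Complex.I)) - Complex.I / a p) by field_simp,
          norm_mul, haprime p p.2, one_mul]
        exact ht p hp
      have him := (abs_le.mp ((Complex.abs_im_le_norm _).trans hclose.le)).1
      rw [Complex.sub_im, Complex.I_im] at him
      linarith
    have hup := (Complex.im_le_norm _).trans (norm_eulerLog_le haprime hσ₂.1 t)
    linarith
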